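/- arXiv:2106.00555 — 2 statements merged into one kernel-verified Lean document; each statement's English description precedes it below -/
import Mathlib

section
/- Let x be a random vector in ℝ^m whose law is the spherical Gaussian mixture Σ_{j=1}^r ω_j N(μ_j, σ_j² I_m) with r ≤ m, set μ̄ = E[x] and σ̃² = Σ_{j=1}^r ω_j σ_j², let v ∈ ℝ^m be a unit eigenvector of the covariance matrix E[(x − μ̄)(x − μ̄)^T] for the eigenvalue σ̃², and let M_1(X) = E[(x·X)(v·(x − μ̄))²]. Then, as an identity of homogeneous polynomials of degree 3 in X = (X_1,…,X_m): E[(x·X)³] − 3 (X_1² + ⋯ + X_m²) M_1(X) = Σ_{j=1}^r ω_j (μ_j·X)³. -/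
open MeasureTheory ProbabilityTheory

/-- The spherical Gaussian measure `N(μ, σ² I_m)` on `ℝ^m`: the law of `μ + σ g` where `g`
is a standard Gaussian vector. -/
noncomputable def sphericalGaussian (m : ℕ) (μ : Fin m → ℝ) (σ : ℝ) :
    Measure (Fin m → ℝ) :=
  Measure.map (fun g => μ + σ • g) (Measure.pi fun _ => gaussianReal 0 1)

/-- The spherical Gaussian mixture `Σ_j ω_j N(μ_j, σ_j² I_m)` on `ℝ^m`. -/
noncomputable def sphericalMixture {r m : ℕ} (ω : Fin r → ℝ) (μ : Fin r → Fin m → ℝ)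
    (σ : Fin r → ℝ) : Measure (Fin m → ℝ) :=
  ∑ j, ENNReal.ofReal (ω j) • sphericalGaussian m (μ j) (σ j)

/-- The mean vector `E[x]` of a measure on `ℝ^m`. -/
noncomputable def meanVec {m : ℕ} (P : Measure (Fin m → ℝ)) : Fin m → ℝ :=
  fun i => ∫ x, x i ∂P

/-- The covariance matrix `E[(x - E[x])(x - E[x])^T]` of a measure on `ℝ^m`. -/
noncomputable def covMatrix {m : ℕ} (P : Measure (Fin m → ℝ)) : Matrix (Fin m) (Fin m) ℝ :=
  fun i l => ∫ x, (x i - meanVec P i) * (x l - meanVec P l) ∂P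

/-- The linear form `u·X = u₁X₁ + ⋯ + uₘXₘ` with real coefficients. -/
noncomputable def linFormR {m : ℕ} (v : Fin m → ℝ) : MvPolynomial (Fin m) ℝ :=
  ∑ i, MvPolynomial.C (v i) * MvPolynomial.X i

/-- Standard Gaussian measure on `Fin m → ℝ`. -/
noncomputable abbrev stdG (m : ℕ) : Measure (Fin m → ℝ) :=
  Measure.pi fun _ => gaussianReal 0 1

/-- linear form -/
noncomputable abbrev lin {m : ℕ} (a : Fin m → ℝ) (g : Fin m → ℝ) : ℝ := ∑ i, a i * g i

lemma holder442 : ENNReal.HolderTriple 4 4 2 := by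
  refine ⟨?_⟩
  rw [← ENNReal.toReal_eq_toReal_iff' (by simp) (by simp), ENNReal.toReal_add (by simp) (by simp)]
  simp only [ENNReal.toReal_inv, ENNReal.toReal_ofNat]
  norm_num

lemma memLp_coord {m : ℕ} (i : Fin m) (p : NNReal) : MemLp (fun g : Fin m → ℝ => g i) p (stdG m) :=
  (memLp_id_gaussianReal p).comp_measurePreserving
    (measurePreserving_eval (fun _ : Fin m => gaussianReal 0 1) i)

lemma memLp_aff {m : ℕ} (α : ℝ) (a : Fin m → ℝ) (p : NNReal) :
    MemLp (fun g => α + lin a g) p (stdG m) := by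
  refine (memLp_const α).add ?_
  exact memLp_finsetSum _ fun i _ => (memLp_coord i p).const_mul (a i)

lemma integrable_aff3 {m : ℕ} (α β γ : ℝ) (a b c : Fin m → ℝ) :
    Integrable (fun g => (α + lin a g) * (β + lin b g) * (γ + lin c g)) (stdG m) := by
  have := holder442
  have h1 : MemLp (fun g => (α + lin a g) * (β + lin b g)) 2 (stdG m) :=
    MemLp.mul' (p := 4) (q := 4) (by simpa using memLp_aff β b 4) (by simpa using memLp_aff α a 4)
  exact h1.integrable_mul (by simpa using memLp_aff γ c 2)

lemma integral_odd {m : ℕ} (f : (Fin m → ℝ) → ℝ) (hf : ∀ g, f (-g) = - f g) :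
    ∫ g, f g ∂(stdG m) = 0 := by
  have hmp : MeasurePreserving (fun g : Fin m → ℝ => fun i => - g i) (stdG m) (stdG m) :=
    measurePreserving_pi _ _ fun i => ⟨measurable_neg, by
      have h := gaussianReal_map_neg (μ := 0) (v := 1)
      rw [neg_zero] at h
      exact h⟩
  have h := hmp.integral_comp (MeasurableEquiv.neg (Fin m → ℝ)).measurableEmbedding f
  have h2 : ∀ g : Fin m → ℝ, f (fun i => - g i) = - f g := hf
  simp only [h2, integral_neg] at h
  linarith

lemma integral_coord2 {m : ℕ} (i l : Fin m) :
    ∫ g, g i * g l ∂(stdG m) = if i = l then 1 else 0 := by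
  have hm : ∀ i : Fin m, ∫ g, g i ∂(stdG m) = 0 := fun i => integral_odd _ (fun g => rfl)
  split_ifs with h
  · subst h
    have : ∫ g, g i * g i ∂(stdG m) = ∫ x, x ^ 2 ∂(gaussianReal 0 1) := by
      rw [← (measurePreserving_eval (fun _ : Fin m => gaussianReal 0 1) i).map_eq, integral_map]
      · simp [sq]
      · exact (measurable_pi_apply i).aemeasurable
      · fun_prop
    rw [this]
    have := variance_fun_id_gaussianReal (μ := 0) (v := 1)
    rw [variance_eq_integral (by fun_prop)] at this
    simpa using this
  · have := (iIndepFun_pi (μ := fun _ : Fin m => gaussianReal 0 1) (X := fun _ => id)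
      (fun i => by fun_prop)).indepFun h
    have := this.integral_fun_mul_eq_mul_integral
      (measurable_pi_apply i).aestronglyMeasurable (measurable_pi_apply l).aestronglyMeasurable
    simp only [id] at this
    rw [this, hm, zero_mul]

lemma integrable_coord2 {m : ℕ} (i l : Fin m) :
    Integrable (fun g : Fin m → ℝ => g i * g l) (stdG m) :=
  MemLp.integrable_mul (p := 2) (q := 2) (by simpa using memLp_coord i 2)
    (by simpa using memLp_coord l 2)

lemma integral_lin2 {m : ℕ} (a b : Fin m → ℝ) :
    ∫ g, lin a g * lin b g ∂(stdG m) = ∑ i, a i * b i := by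
  have : ∀ g : Fin m → ℝ, lin a g * lin b g = ∑ i, ∑ l, (a i * b l) * (g i * g l) := by
    intro g
    rw [Finset.sum_mul_sum]
    exact Finset.sum_congr rfl fun i _ => Finset.sum_congr rfl fun l _ => by ring
  simp_rw [this]
  rw [integral_finsetSum _ fun i _ => integrable_finsetSum _ fun l _ =>
    (integrable_coord2 i l).const_mul _]
  refine Finset.sum_congr rfl fun i _ => ?_
  rw [integral_finsetSum _ fun l _ => (integrable_coord2 i l).const_mul _]
  simp_rw [integral_const_mul, integral_coord2]
  simp

lemma lin_neg {m : ℕ} (a g : Fin m → ℝ) : lin a (-g) = - lin a g := by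
  simp [lin]

lemma integral_aff3 {m : ℕ} (α β γ : ℝ) (a b c : Fin m → ℝ) :
    ∫ g, (α + lin a g) * (β + lin b g) * (γ + lin c g) ∂(stdG m)
      = α * β * γ + α * ∑ i, b i * c i + β * ∑ i, a i * c i + γ * ∑ i, a i * b i := by
  have i2 : ∀ a b : Fin m → ℝ, Integrable (fun g => lin a g * lin b g) (stdG m) := fun a b => by
    simpa [lin] using integrable_aff3 0 0 1 a b 0
  have i0 : ∀ f : (Fin m → ℝ) → ℝ, (∀ g, f g = (α + lin a g) * (β + lin b g) * (γ + lin c g)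
      - (α * β * γ + α * (lin b g * lin c g) + β * (lin a g * lin c g) + γ * (lin a g * lin b g)))
      → Integrable f (stdG m) := fun f hf => by
    rw [funext hf]
    exact (integrable_aff3 _ _ _ _ _ _).sub (((integrable_const _).add ((i2 _ _).const_mul _)).add
      ((i2 _ _).const_mul _) |>.add ((i2 _ _).const_mul _))
  have key : ∀ g, (α + lin a g) * (β + lin b g) * (γ + lin c g) =
      (α * β * γ + α * (lin b g * lin c g) + β * (lin a g * lin c g) + γ * (lin a g * lin b g))
      + (α * β * lin c g + α * γ * lin b g + β * γ * lin a g + lin a g * lin b g * lin c g) := by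
    intro g; ring
  have hodd := integral_odd (m := m) (fun g => α * β * lin c g + α * γ * lin b g + β * γ * lin a g
    + lin a g * lin b g * lin c g) (fun g => by simp only [lin_neg]; ring)
  simp_rw [key]
  rw [integral_add _ (i0 _ fun g => by ring), hodd, integral_add, integral_add, integral_add,
    integral_const_mul α, integral_const_mul β, integral_const_mul γ, integral_lin2,
    integral_lin2, integral_lin2]
  · simp
  · exact integrable_const _
  · exact (i2 _ _).const_mul _
  · exact (integrable_const _).add ((i2 _ _).const_mul _)
  · exact (i2 _ _).const_mul _
  · exact ((integrable_const _).add ((i2 _ _).const_mul _)).add ((i2 _ _).const_mul _)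
  · exact (i2 _ _).const_mul _
  · exact (((integrable_const _).add ((i2 _ _).const_mul _)).add
      ((i2 _ _).const_mul _) |>.add ((i2 _ _).const_mul _))

lemma aff_comp {m : ℕ} (α : ℝ) (a μ : Fin m → ℝ) (σ : ℝ) (g : Fin m → ℝ) :
    α + lin a (μ + σ • g) = (α + lin a μ) + lin (σ • a) g := by
  simp only [lin, Pi.add_apply, Pi.smul_apply, smul_eq_mul, mul_add, Finset.sum_add_distrib]
  rw [add_assoc]
  congr 2
  exact Finset.sum_congr rfl fun i _ => by ring

lemma integral_mix {r m : ℕ} (ω : Fin r → ℝ) (hω : ∀ j, 0 < ω j) (μ : Fin r → Fin m → ℝ)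
    (σ : Fin r → ℝ) (α β γ : ℝ) (a b c : Fin m → ℝ) :
    ∫ x, (α + lin a x) * (β + lin b x) * (γ + lin c x) ∂(sphericalMixture ω μ σ)
      = ∑ j, ω j * ((α + lin a (μ j)) * (β + lin b (μ j)) * (γ + lin c (μ j))
        + σ j ^ 2 * ((α + lin a (μ j)) * ∑ i, b i * c i + (β + lin b (μ j)) * ∑ i, a i * c i
          + (γ + lin c (μ j)) * ∑ i, a i * b i)) := by
  have hc : Continuous (fun x : Fin m → ℝ => (α + lin a x) * (β + lin b x) * (γ + lin c x)) := by
    unfold lin; fun_prop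
  have hmeas : ∀ j, Measurable (fun g : Fin m → ℝ => μ j + σ j • g) := fun j => by fun_prop
  have hs : ∀ (s : ℝ) (a b : Fin m → ℝ), ∑ i, (s • a) i * (s • b) i = s ^ 2 * ∑ i, a i * b i := by
    intro s a b
    rw [Finset.mul_sum]
    exact Finset.sum_congr rfl fun i _ => by simp; ring
  unfold sphericalMixture sphericalGaussian
  rw [integral_finsetSum_measure]
  · refine Finset.sum_congr rfl fun j _ => ?_
    rw [integral_smul_measure, ENNReal.toReal_ofReal (hω j).le,
      integral_map (hmeas j).aemeasurable hc.aestronglyMeasurable]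
    simp_rw [aff_comp]
    rw [integral_aff3]
    simp only [hs, smul_eq_mul]
    ring
  · intro j _
    refine Integrable.smul_measure ?_ (by simp)
    rw [integrable_map_measure hc.aestronglyMeasurable (hmeas j).aemeasurable]
    simp only [Function.comp_def, aff_comp]
    exact integrable_aff3 _ _ _ _ _ _

lemma lin_single {m : ℕ} (i : Fin m) (x : Fin m → ℝ) : lin (Pi.single i 1) x = x i := by
  simp [lin, Pi.single_apply]

lemma sum_single_mul {m : ℕ} (i : Fin m) (b : Fin m → ℝ) :
    ∑ k, (Pi.single i 1 : Fin m → ℝ) k * b k = b i := lin_single i b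

lemma mom3 {r m : ℕ} (ω : Fin r → ℝ) (hω : ∀ j, 0 < ω j) (μ : Fin r → Fin m → ℝ)
    (σ : Fin r → ℝ) (i l s : Fin m) :
    ∫ x, x i * x l * x s ∂(sphericalMixture ω μ σ)
      = ∑ j, ω j * (μ j i * μ j l * μ j s + σ j ^ 2 * (μ j i * (if l = s then 1 else 0)
        + μ j l * (if i = s then 1 else 0) + μ j s * (if i = l then 1 else 0))) := by
  have h := integral_mix ω hω μ σ 0 0 0 (Pi.single i 1) (Pi.single l 1) (Pi.single s 1)
  simp only [lin_single, sum_single_mul, zero_add] at h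
  simp only [Pi.single_apply] at h
  exact h

lemma cov2 {r m : ℕ} (ω : Fin r → ℝ) (hω : ∀ j, 0 < ω j) (μ : Fin r → Fin m → ℝ)
    (σ : Fin r → ℝ) (c : Fin m → ℝ) (i l : Fin m) :
    ∫ x, (x i - c i) * (x l - c l) ∂(sphericalMixture ω μ σ)
      = ∑ j, ω j * ((μ j i - c i) * (μ j l - c l) + σ j ^ 2 * (if i = l then 1 else 0)) := by
  have h := integral_mix ω hω μ σ (-c i) (-c l) 1 (Pi.single i 1) (Pi.single l 1) 0
  have h0 : ∀ x : Fin m → ℝ, lin 0 x = 0 := fun x => by simp [lin]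
  simp only [lin_single, sum_single_mul, h0, add_zero, mul_one, Pi.zero_apply,
    mul_zero, zero_add, one_mul, neg_add_eq_sub, Finset.sum_const_zero] at h
  simp only [Pi.single_apply] at h
  exact h

lemma m1coef {r m : ℕ} (ω : Fin r → ℝ) (hω : ∀ j, 0 < ω j) (μ : Fin r → Fin m → ℝ)
    (σ : Fin r → ℝ) (c v : Fin m → ℝ) (hv : ∑ i, v i ^ 2 = 1)
    (h0 : ∀ j, ∑ l, v l * (μ j l - c l) = 0) (i : Fin m) :
    ∫ x, x i * (∑ l, v l * (x l - c l)) ^ 2 ∂(sphericalMixture ω μ σ)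
      = ∑ j, ω j * (σ j ^ 2 * μ j i) := by
  have h := integral_mix ω hω μ σ 0 (- lin v c) (- lin v c) (Pi.single i 1) v v
  have hl : ∀ x : Fin m → ℝ, - lin v c + lin v x = ∑ l, v l * (x l - c l) := fun x => by
    simp only [lin, mul_sub, Finset.sum_sub_distrib]; ring
  have hv' : ∑ i, v i * v i = 1 := by rw [← hv]; exact Finset.sum_congr rfl fun i _ => by ring
  simp only [lin_single, sum_single_mul, hl, h0, zero_add, zero_mul, mul_zero, add_zero, hv',
    mul_one] at h
  rw [← h]
  congr 1; ext x; ring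

lemma cov_zero {r m : ℕ} (ω : Fin r → ℝ) (hω : ∀ j, 0 < ω j) (u : Fin r → Fin m → ℝ)
    (σ : Fin r → ℝ) (v : Fin m → ℝ) (hv : ∑ i, v i ^ 2 = 1)
    (h : ∀ i, ∑ l, (∑ j, ω j * (u j i * u j l + σ j ^ 2 * (if i = l then 1 else 0))) * v l
      = (∑ j, ω j * σ j ^ 2) * v i) (j : Fin r) : ∑ l, v l * u j l = 0 := by
  have h1 : ∀ i, ∑ l, (∑ j, ω j * (u j i * u j l + σ j ^ 2 * (if i = l then 1 else 0))) * v l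
      = (∑ j, ω j * (u j i * ∑ l, v l * u j l)) + (∑ j, ω j * σ j ^ 2) * v i := by
    intro i
    have : ∀ l, (∑ j, ω j * (u j i * u j l + σ j ^ 2 * (if i = l then 1 else 0))) * v l
      = (∑ j, ω j * (u j i * (v l * u j l))) + (if i = l then (∑ j, ω j * σ j ^ 2) * v l else 0) := by
      intro l
      split_ifs
      · rw [Finset.sum_mul, Finset.sum_mul, ← Finset.sum_add_distrib]
        exact Finset.sum_congr rfl fun j _ => by ring
      · rw [Finset.sum_mul, add_zero]
        exact Finset.sum_congr rfl fun j _ => by ring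
    rw [Finset.sum_congr rfl fun l _ => this l, Finset.sum_add_distrib, Finset.sum_comm]
    simp [Finset.mul_sum]
  have h2 : ∀ i, ∑ j, ω j * (u j i * ∑ l, v l * u j l) = 0 := fun i => by
    have := h1 i; rw [h i] at this; linarith
  have h3 : ∑ j, ω j * (∑ l, v l * u j l) ^ 2 = 0 := by
    calc ∑ j, ω j * (∑ l, v l * u j l) ^ 2
        = ∑ j, ∑ i, v i * (ω j * (u j i * ∑ l, v l * u j l)) := by
          refine Finset.sum_congr rfl fun j _ => ?_
          rw [sq, ← mul_assoc, Finset.mul_sum]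
          exact Finset.sum_congr rfl fun i _ => by ring
      _ = ∑ i, v i * ∑ j, ω j * (u j i * ∑ l, v l * u j l) := by
          rw [Finset.sum_comm]; simp only [Finset.mul_sum]
      _ = 0 := by simp [h2]
  have h4 := (Finset.sum_eq_zero_iff_of_nonneg
    (fun j _ => mul_nonneg (hω j).le (sq_nonneg _))).1 h3 j (Finset.mem_univ j)
  simpa [(hω j).ne'] using h4

lemma cube_alg {m : ℕ} (M t : Fin m → ℝ) (q : ℝ) :
    ∑ i, ∑ l, ∑ s, (M i * M l * M s + q * (M i * (if l = s then 1 else 0)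
        + M l * (if i = s then 1 else 0) + M s * (if i = l then 1 else 0))) * (t i * t l * t s)
      = (∑ i, M i * t i) ^ 3 + 3 * (∑ i, t i ^ 2) * (q * ∑ i, M i * t i) := by
  set A := ∑ i, M i * t i with hA
  set B := ∑ i, t i ^ 2 with hB
  have hs : ∀ i l, ∑ s, (M i * M l * M s + q * (M i * (if l = s then 1 else 0)
        + M l * (if i = s then 1 else 0) + M s * (if i = l then 1 else 0))) * (t i * t l * t s)
      = (M i * t i) * (M l * t l) * A + q * (M i * t i) * t l ^ 2 + q * t i ^ 2 * (M l * t l)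
        + (if i = l then q * t i * t l * A else 0) := by
    intro i l
    have : ∀ s, (M i * M l * M s + q * (M i * (if l = s then 1 else 0)
        + M l * (if i = s then 1 else 0) + M s * (if i = l then 1 else 0))) * (t i * t l * t s)
      = (M i * t i) * (M l * t l) * (M s * t s) + (if l = s then q * (M i * t i) * t l * t s else 0)
        + (if i = s then q * t i * t s * (M l * t l) else 0)
        + (if i = l then q * t i * t l else 0) * (M s * t s) := by
      intro s
      split_ifs <;> ring
    rw [Finset.sum_congr rfl fun s _ => this s]
    simp only [Finset.sum_add_distrib, ← Finset.mul_sum, ← hA, Finset.sum_ite_eq, Finset.mem_univ,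
      if_true]
    split_ifs <;> ring
  simp only [hs, Finset.sum_add_distrib, ← Finset.mul_sum, ← Finset.sum_mul, ← hA, ← hB,
    Finset.sum_ite_eq, Finset.mem_univ, if_true]
  have : ∑ i, q * t i * t i = q * B := by
    rw [hB, Finset.mul_sum]; exact Finset.sum_congr rfl fun i _ => by ring
  rw [this]
  ring

open MvPolynomial in
/-- with M₁(X) = E[(x·X)(v·(x-μ̄))²] (v a unit eigenvector of the covariance
for the eigenvalue σ̃²), E[(x·X)³] - 3 (X₁²+⋯+Xₘ²) M₁(X) = Σ_j ω_j (μ_j·X)³.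
Since (x·X)³ = Σ_{i,l,s} x_i x_l x_s X_i X_l X_s, its coefficientwise expectation is
Σ_{i,l,s} E[x_i x_l x_s] X_i X_l X_s. -/
theorem statement_3 (m r : ℕ) (hrm : r ≤ m)
    (ω : Fin r → ℝ) (hω : ∀ j, 0 < ω j) (hωsum : ∑ j, ω j = 1)
    (μ : Fin r → Fin m → ℝ) (σ : Fin r → ℝ) (hσ : ∀ j, 0 < σ j)
    (P : Measure (Fin m → ℝ)) (hP : P = sphericalMixture ω μ σ)
    (v : Fin m → ℝ) (hv : ∑ i, v i ^ 2 = 1)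
    (hveig : (covMatrix P).mulVec v = (∑ j, ω j * σ j ^ 2) • v)
    (M₁ : MvPolynomial (Fin m) ℝ)
    (hM₁ : M₁ = ∑ i, C (∫ x, x i * (∑ l, v l * (x l - meanVec P l)) ^ 2 ∂P) * X i) :
    (∑ i, ∑ l, ∑ s, C (∫ x, x i * x l * x s ∂P) * (X i * X l * X s))
        - 3 * (∑ i, (X i : MvPolynomial (Fin m) ℝ) ^ 2) * M₁
      = ∑ j, C (ω j) * linFormR (μ j) ^ 3 := by
  subst hP
  have hz : ∀ j, ∑ l, v l * (μ j l - meanVec (sphericalMixture ω μ σ) l) = 0 := by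
    refine cov_zero ω hω (fun j l => μ j l - meanVec (sphericalMixture ω μ σ) l) σ v hv ?_
    intro i
    have := congrFun hveig i
    simp only [Matrix.mulVec, dotProduct, covMatrix, cov2 ω hω, Pi.smul_apply, smul_eq_mul] at this
    exact this
  simp only [m1coef ω hω μ σ _ v hv hz] at hM₁
  subst hM₁
  apply MvPolynomial.funext
  intro t
  simp only [linFormR, map_sub, map_sum, map_mul, map_pow, eval_C, eval_X, map_ofNat, mom3 ω hω]
  have h1 : ∑ i, (∑ j, ω j * (σ j ^ 2 * μ j i)) * t i
      = ∑ j, ω j * (σ j ^ 2 * ∑ i, μ j i * t i) := by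
    simp only [Finset.sum_mul, Finset.mul_sum]
    rw [Finset.sum_comm]
    exact Finset.sum_congr rfl fun j _ => Finset.sum_congr rfl fun i _ => by ring
  have h2 : ∀ F : Fin r → Fin m → Fin m → Fin m → ℝ,
      ∑ i, ∑ l, ∑ s, (∑ j, ω j * F j i l s) * (t i * t l * t s)
      = ∑ j, ω j * ∑ i, ∑ l, ∑ s, F j i l s * (t i * t l * t s) := by
    intro F
    simp only [Finset.sum_mul, Finset.mul_sum]
    simp_rw [Finset.sum_comm (s := Finset.univ (α := Fin m)) (t := Finset.univ (α := Fin r))]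
    simp only [mul_assoc]
  rw [h1, h2, Finset.mul_sum, ← Finset.sum_sub_distrib]
  refine Finset.sum_congr rfl fun j _ => ?_
  rw [cube_alg]
  ring
end

section
/- Let T ∈ ℂ[X]_d with T = Σ_{i=1}^r ω_i (ξ_i·X)^d, ω_i ∈ ℂ nonzero, ξ_i ∈ ℂ^m nonzero spanning pairwise distinct lines, and suppose rank H_T^{k,d−k} = r for some k with ι(ξ_1,…,ξ_r) + 1 ≤ k ≤ d. Let U ∈ ℂ^{s_k × r} have column space equal to that of H_T^{k,d−k}, with submatrices U_i as above. Suppose E ∈ ℂ^{s_{k−1} × s_{k−1}} and F ∈ ℂ^{r × r} are invertible matrices such that for every i ∈ {1,…,m}, E^t U_i F has top r × r block equal to a diagonal matrix Δ_i and zero remaining rows. Define ξ'_j ∈ ℂ^m by conj(ξ'_j) = ((Δ_1)_{jj},…,(Δ_m)_{jj}) for j ∈ {1,…,r}. Then there exist unique ω'_1,…,ω'_r ∈ ℂ such that T = Σ_{j=1}^r ω'_j (ξ'_j·X)^d. -/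
open MvPolynomial Matrix

/-- The linear form `v·X = v₁X₁ + ⋯ + vₘXₘ`. -/
noncomputable def linForm {m : ℕ} (v : Fin m → ℂ) : MvPolynomial (Fin m) ℂ :=
  ∑ i, C (v i) * X i

/-- The apolar product `⟨p,q⟩_d = Σ_{|α|=d} C(d,α) conj(p_α) q_α` of two homogeneous
polynomials of degree d, written in terms of the plain coefficients of p and q. -/
noncomputable def apolar {m : ℕ} (p q : MvPolynomial (Fin m) ℂ) : ℂ :=
  ∑ α ∈ p.support ∩ q.support,
    (starRingEnd ℂ) (MvPolynomial.coeff α p) * MvPolynomial.coeff α q /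
      (Nat.multinomial α.support α : ℂ)

/-- The monomial `X^γ`. -/
noncomputable def monomOf {m : ℕ} (γ : Fin m → ℕ) : MvPolynomial (Fin m) ℂ :=
  ∏ i, X i ^ γ i

/-- The Hankel matrix `H_T^{k,d-k}`: rows indexed by exponents α with |α| = k, columns
indexed by exponents β with |β| = d-k, entries `⟨T, X^{α+β}⟩_d`. -/
noncomputable def hankel (m d k : ℕ) (T : MvPolynomial (Fin m) ℂ) :
    Matrix (Finset.Nat.antidiagonalTuple m k) (Finset.Nat.antidiagonalTuple m (d - k)) ℂ :=
  fun α β => apolar T (monomOf ((α : Fin m → ℕ) + (β : Fin m → ℕ)))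

/-- The vector `ξ^{(k)} = (ξ^α)_{|α|=k}`. -/
noncomputable def powVec {m : ℕ} (k : ℕ) (ξ : Fin m → ℂ) :
    Finset.Nat.antidiagonalTuple m k → ℂ :=
  fun α => ∏ j, ξ j ^ (α : Fin m → ℕ) j


/-- The interpolation degree ι(Ξ) of Ξ = {ξ₁,…,ξ_r}: the smallest k for which there is a
family of homogeneous interpolation polynomials of degree k at the points Ξ. -/
noncomputable def interpolationDegree {r m : ℕ} (ξ : Fin r → Fin m → ℂ) : ℕ :=
  sInf {k | ∃ u : Fin r → MvPolynomial (Fin m) ℂ,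
    (∀ i, (u i).IsHomogeneous k) ∧
    ∀ i j, MvPolynomial.eval (ξ j) (u i) = if i = j then 1 else 0}

/-- The submatrix `U_i` of `U` formed by the rows indexed by the exponents divisible by
`X_i`, i.e. of the form `e_i + α` with `|α| = k-1` (`e_i` the i-th unit exponent). -/
noncomputable def subRows {m k r : ℕ} (i : Fin m)
    (U : Matrix (Finset.Nat.antidiagonalTuple m k) (Fin r) ℂ) :
    Matrix (Finset.Nat.antidiagonalTuple m (k - 1)) (Fin r) ℂ :=
  fun α j =>
    if h : (fun l => (if l = i then 1 else 0) + (α : Fin m → ℕ) l) ∈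
        Finset.Nat.antidiagonalTuple m k
    then U ⟨_, h⟩ j else 0


lemma aux_coeff_linForm {m : ℕ} (v : Fin m → ℂ) (d : ℕ) (γ : Fin m → ℕ) (hγ : ∑ i, γ i = d) :
    coeff (Finsupp.equivFunOnFinite.symm γ) (linForm v ^ d) =
      (Nat.multinomial (Finsupp.equivFunOnFinite.symm γ).support γ : ℂ) * ∏ i, v i ^ γ i := by
  have h := coeff_linearCombination_X_pow_of_fintype v (Finsupp.equivFunOnFinite.symm γ) d
  simp only [smul_eq_C_mul] at h
  unfold linForm
  rw [h, if_pos]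
  · rw [Finsupp.multinomial_eq]
    congr 1
    rw [Finsupp.prod_fintype _ _ (by simp)]
    simp
  · rw [Finsupp.sum_fintype _ _ (by simp)]
    simpa using hγ

lemma aux_monomOf {m : ℕ} (γ : Fin m → ℕ) :
    monomOf γ = monomial (Finsupp.equivFunOnFinite.symm γ) (1 : ℂ) := by
  unfold monomOf
  rw [monomial_eq, Finsupp.prod_fintype _ _ (by simp)]
  simp

lemma aux_apolar {m : ℕ} (T : MvPolynomial (Fin m) ℂ) (γ : Fin m → ℕ) :
    apolar T (monomOf γ) = (starRingEnd ℂ) (coeff (Finsupp.equivFunOnFinite.symm γ) T) /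
      (Nat.multinomial (Finsupp.equivFunOnFinite.symm γ).support γ : ℂ) := by
  classical
  unfold apolar
  rw [aux_monomOf, support_monomial, if_neg one_ne_zero]
  by_cases h : Finsupp.equivFunOnFinite.symm γ ∈ T.support
  · rw [Finset.inter_singleton_of_mem h]
    simp
  · rw [Finset.inter_singleton_of_notMem h]
    rw [notMem_support_iff] at h
    simp [h]

lemma aux_apolar_T {m d r : ℕ} (ω : Fin r → ℂ) (ξ : Fin r → Fin m → ℂ) (γ : Fin m → ℕ)
    (hγ : ∑ i, γ i = d) :
    apolar (∑ i, C (ω i) * linForm (ξ i) ^ d) (monomOf γ) =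
      ∑ i, (starRingEnd ℂ) (ω i) * ∏ l, (starRingEnd ℂ) (ξ i l) ^ γ l := by
  rw [aux_apolar, coeff_sum]
  simp only [coeff_C_mul, aux_coeff_linForm _ d γ hγ, map_sum, map_mul, map_prod, map_pow,
    map_natCast]
  rw [Finset.sum_div]
  refine Finset.sum_congr rfl fun i _ => ?_
  have : (Nat.multinomial (Finsupp.equivFunOnFinite.symm γ).support γ : ℂ) ≠ 0 := by
    exact_mod_cast (Nat.multinomial_pos _ _).ne'
  field_simp

lemma aux_sep {m : ℕ} (v w : Fin m → ℂ) (hw : w ≠ 0) (h : ∀ c : ℂ, v ≠ c • w) :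
    ∃ p : MvPolynomial (Fin m) ℂ, p.IsHomogeneous 1 ∧ eval v p = 1 ∧ eval w p = 0 := by
  obtain ⟨a, ha⟩ := Function.ne_iff.mp hw
  obtain ⟨b, hb⟩ := Function.ne_iff.mp (h (v a / w a))
  simp only [Pi.zero_apply, Pi.smul_apply, smul_eq_mul] at ha hb
  have hne : w a * v b - w b * v a ≠ 0 := by
    intro h0
    apply hb
    field_simp
    linear_combination h0
  refine ⟨C ((w a * v b - w b * v a)⁻¹) * (C (w a) * X b - C (w b) * X a), ?_, ?_, ?_⟩
  · exact ((isHomogeneous_C_mul_X _ _).sub (isHomogeneous_C_mul_X _ _)).C_mul _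
  · simp [hne]
  · simp; right; ring

lemma aux_interp {m r n : ℕ} (ξ : Fin r → Fin m → ℂ) (hξ0 : ∀ i, ξ i ≠ 0)
    (hlines : ∀ i j, i ≠ j → ∀ c : ℂ, ξ i ≠ c • ξ j) (hn : interpolationDegree ξ ≤ n) :
    ∃ u : Fin r → MvPolynomial (Fin m) ℂ, (∀ i, (u i).IsHomogeneous n) ∧
    ∀ i j, MvPolynomial.eval (ξ j) (u i) = if i = j then 1 else 0 := by
  classical
  have hne : {k | ∃ u : Fin r → MvPolynomial (Fin m) ℂ,
    (∀ i, (u i).IsHomogeneous k) ∧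
    ∀ i j, MvPolynomial.eval (ξ j) (u i) = if i = j then 1 else 0}.Nonempty := by
    have hs : ∀ i j, ∃ p : MvPolynomial (Fin m) ℂ, i ≠ j → p.IsHomogeneous 1 ∧
        eval (ξ i) p = 1 ∧ eval (ξ j) p = 0 := by
      intro i j
      by_cases hij : i = j
      · exact ⟨0, fun h => absurd hij h⟩
      · obtain ⟨p, hp⟩ := aux_sep (ξ i) (ξ j) (hξ0 j) (hlines i j hij)
        exact ⟨p, fun _ => hp⟩
    choose p hp using hs
    refine ⟨r - 1, fun i => ∏ j ∈ Finset.univ.erase i, p i j, ?_, ?_⟩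
    · intro i
      have := IsHomogeneous.prod (Finset.univ.erase i) (p i) (fun _ => 1)
        (fun j hj => (hp i j (Finset.ne_of_mem_erase hj).symm).1)
      simpa using this
    · intro i j
      rw [map_prod]
      split_ifs with hij
      · subst hij
        exact Finset.prod_eq_one fun l hl => (hp i l (Finset.ne_of_mem_erase hl).symm).2.1
      · exact Finset.prod_eq_zero (i := j) (by simp [Ne.symm hij]) (hp i j hij).2.2
  obtain ⟨u, hu, hev⟩ := Nat.sInf_mem hne
  change ∀ i, (u i).IsHomogeneous (interpolationDegree ξ) at hu
  have ha : ∀ i, ∃ a, ξ i a ≠ 0 := fun i => Function.ne_iff.mp (hξ0 i)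
  choose a ha using ha
  refine ⟨fun i => u i * (C (ξ i (a i))⁻¹ * X (a i)) ^ (n - interpolationDegree ξ), ?_, ?_⟩
  · intro i
    have := (hu i).mul ((isHomogeneous_C_mul_X (ξ i (a i))⁻¹ (a i)).pow
      (n - interpolationDegree ξ))
    rwa [one_mul, Nat.add_sub_cancel' hn] at this
  · intro i j
    rw [map_mul, hev]
    split_ifs with hij
    · subst hij
      simp [ha]
    · simp

lemma aux_interp_coeff {m r n : ℕ} (ξ : Fin r → Fin m → ℂ) (hξ0 : ∀ i, ξ i ≠ 0)
    (hlines : ∀ i j, i ≠ j → ∀ c : ℂ, ξ i ≠ c • ξ j) (hn : interpolationDegree ξ ≤ n) :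
    ∃ c : Fin r → (Fin m → ℕ) → ℂ, ∀ i j,
      ∑ α : Finset.Nat.antidiagonalTuple m n, c i α * ∏ l, ξ j l ^ (α : Fin m → ℕ) l =
        if i = j then 1 else 0 := by
  classical
  obtain ⟨u, hu, hev⟩ := aux_interp ξ hξ0 hlines hn
  refine ⟨fun i α => coeff (Finsupp.equivFunOnFinite.symm α) (u i), fun i j => ?_⟩
  rw [← hev i j, eval_eq', Finset.sum_coe_sort (Finset.Nat.antidiagonalTuple m n)
    (fun α => coeff (Finsupp.equivFunOnFinite.symm α) (u i) * ∏ l, ξ j l ^ α l)]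
  symm
  refine Finset.sum_bij_ne_zero (fun a _ _ => (a : Fin m → ℕ)) ?_ ?_ ?_ ?_
  · intro a ha _
    rw [Finset.Nat.mem_antidiagonalTuple]
    have := (hu i).degree_eq_sum_deg_support ha
    rw [this, ]
    exact (Finsupp.sum_fintype a (fun _ x => x) (by simp)).symm
  · intro a _ _ b _ _ h
    exact DFunLike.coe_injective h
  · intro b _ hb
    refine ⟨Finsupp.equivFunOnFinite.symm b, ?_, ?_, ?_⟩
    · rw [mem_support_iff]
      exact left_ne_zero_of_mul hb
    · simpa using hb
    · simp
  · intro a _ _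
    simp

/-- under the hypotheses of the identifiability theorem, if invertible
matrices E, F simultaneously diagonalise the pencil U₁,…,Uₘ — i.e. each Eᵀ Uᵢ F has (up
to the row ordering encoded by the injection ρ) top r×r block equal to a diagonal matrix
with entries Δ i j and zero remaining rows — then, setting ξ'_j with
conj(ξ'_j) = ((Δ₁)_{jj},…,(Δₘ)_{jj}), there are unique weights ω'_j with
T = Σ_j ω'_j (ξ'_j·X)^d. -/
theorem statement_19 (m d k r : ℕ)
    (ω : Fin r → ℂ) (hω : ∀ i, ω i ≠ 0)
    (ξ : Fin r → Fin m → ℂ) (hξ0 : ∀ i, ξ i ≠ 0)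
    (hlines : ∀ i j, i ≠ j → ∀ c : ℂ, ξ i ≠ c • ξ j)
    (T : MvPolynomial (Fin m) ℂ) (hT : T = ∑ i, C (ω i) * linForm (ξ i) ^ d)
    (hk1 : interpolationDegree ξ + 1 ≤ k) (hkd : k ≤ d)
    (hrank : (hankel m d k T).rank = r)
    (U : Matrix (Finset.Nat.antidiagonalTuple m k) (Fin r) ℂ)
    (hU : LinearMap.range U.mulVecLin = LinearMap.range (hankel m d k T).mulVecLin)
    (E : Matrix (Finset.Nat.antidiagonalTuple m (k - 1))
        (Finset.Nat.antidiagonalTuple m (k - 1)) ℂ)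
    (F : Matrix (Fin r) (Fin r) ℂ) (hE : IsUnit E) (hF : IsUnit F)
    (ρ : Fin r ↪ Finset.Nat.antidiagonalTuple m (k - 1))
    (Δ : Fin m → Fin r → ℂ)
    (hdiag : ∀ (i : Fin m) (α : Finset.Nat.antidiagonalTuple m (k - 1)) (j : Fin r),
      (Eᵀ * subRows i U * F) α j = if α = ρ j then Δ i j else 0)
    (ξ' : Fin r → Fin m → ℂ)
    (hξ' : ∀ j i, (starRingEnd ℂ) (ξ' j i) = Δ i j) :
    ∃! ω' : Fin r → ℂ, T = ∑ j, C (ω' j) * linForm (ξ' j) ^ d := by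
  classical
  obtain ⟨c, hc⟩ := aux_interp_coeff (n := k - 1) ξ hξ0 hlines (by omega)
  obtain ⟨c', hc'⟩ := aux_interp_coeff (n := d) ξ hξ0 hlines (by omega)
  have hk : k - 1 + 1 = k := by omega
  let V : (n : ℕ) → Matrix (Finset.Nat.antidiagonalTuple m n) (Fin r) ℂ :=
    fun n α i => ∏ l, (starRingEnd ℂ) (ξ i l) ^ (α : Fin m → ℕ) l
  let N : Matrix (Fin r) (Finset.Nat.antidiagonalTuple m (d - k)) ℂ :=
    fun i β => (starRingEnd ℂ) (ω i) * V (d - k) β i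
  have hH : hankel m d k T = V k * N := by
    ext α β
    have hα := Finset.Nat.mem_antidiagonalTuple.mp α.2
    have hβ := Finset.Nat.mem_antidiagonalTuple.mp β.2
    unfold hankel
    rw [hT, aux_apolar_T, Matrix.mul_apply]
    · refine Finset.sum_congr rfl fun i _ => ?_
      simp only [V, N, Pi.add_apply, pow_add, Finset.prod_mul_distrib]
      ring
    · simp only [Pi.add_apply, Finset.sum_add_distrib, hα, hβ]
      omega
  have hcol : ∀ j, ∃ x, (hankel m d k T).mulVec x = U.col j := by
    intro j
    have : U.col j ∈ LinearMap.range U.mulVecLin :=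
      ⟨Pi.single j 1, by simp⟩
    rw [hU] at this
    obtain ⟨x, hx⟩ := this
    exact ⟨x, by simpa using hx⟩
  choose x hx using hcol
  let G : Matrix (Fin r) (Fin r) ℂ := Matrix.of fun i j => (N.mulVec (x j)) i
  have hUG : U = V k * G := by
    ext α j
    have := congrFun (hx j) α
    rw [hH, ← Matrix.mulVec_mulVec] at this
    rw [Matrix.col_apply] at this
    rw [← this]
    rfl
  have hG : IsUnit G := by
    have h1 : U.rank = r := by
      refine Eq.trans ?_ hrank; unfold Matrix.rank; rw [hU]
    have h2 : r ≤ G.rank := by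
      calc r = (V k * G).rank := by rw [← hUG, h1]
        _ ≤ G.rank := Matrix.rank_mul_le_right _ _
    have h3 : LinearMap.range G.mulVecLin = ⊤ := by
      apply Submodule.eq_top_of_finrank_eq
      apply le_antisymm (Submodule.finrank_le _)
      rw [Module.finrank_fin_fun]
      exact h2
    rw [← Matrix.mulVec_surjective_iff_isUnit]
    exact LinearMap.range_eq_top.mp h3
  have hB : IsUnit (G * F) := hG.mul hF
  have hsub : ∀ i, subRows i U = V (k - 1) *
      Matrix.diagonal (fun l => (starRingEnd ℂ) (ξ l i)) * G := by
    intro i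
    ext α j
    have hα := Finset.Nat.mem_antidiagonalTuple.mp α.2
    have hmem : (fun l => (if l = i then 1 else 0) + (α : Fin m → ℕ) l) ∈
        Finset.Nat.antidiagonalTuple m k := by
      rw [Finset.Nat.mem_antidiagonalTuple, Finset.sum_add_distrib, hα]
      simp; omega
    unfold subRows
    rw [dif_pos hmem, hUG, Matrix.mul_apply, Matrix.mul_apply]
    refine Finset.sum_congr rfl fun l _ => ?_
    rw [Matrix.mul_diagonal]
    congr 1
    simp only [V, pow_add, Finset.prod_mul_distrib]
    rw [mul_comm]
    congr 1
    simp [Finset.prod_ite_eq', pow_ite]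
  let W : Matrix (Fin r) (Finset.Nat.antidiagonalTuple m (k - 1)) ℂ :=
    fun i α => (starRingEnd ℂ) (c i α)
  have hWV : W * V (k - 1) = 1 := by
    ext i j
    have := congrArg (starRingEnd ℂ) (hc i j)
    rw [Matrix.mul_apply, Matrix.one_apply]
    simp only [map_sum, map_mul, map_prod, map_pow, apply_ite (starRingEnd ℂ), map_one,
      map_zero] at this
    exact this
  have hEt : IsUnit Eᵀ := (Matrix.isUnit_transpose E).mpr hE
  have hEinv : (Eᵀ)⁻¹ * Eᵀ = 1 :=
    Matrix.nonsing_inv_mul _ ((Matrix.isUnit_iff_isUnit_det _).mp hEt)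
  let L := W * (Eᵀ)⁻¹
  have key : ∀ i l j, (starRingEnd ℂ) (ξ l i) * (G * F) l j = L l (ρ j) * Δ i j := by
    intro i l j
    have h1 : L * (Eᵀ * subRows i U * F) =
        Matrix.diagonal (fun l => (starRingEnd ℂ) (ξ l i)) * (G * F) := by
      rw [hsub]
      calc W * (Eᵀ)⁻¹ * (Eᵀ * (V (k - 1) *
            Matrix.diagonal (fun l => (starRingEnd ℂ) (ξ l i)) * G) * F)
          = W * ((Eᵀ)⁻¹ * Eᵀ) * V (k - 1) *
            (Matrix.diagonal (fun l => (starRingEnd ℂ) (ξ l i)) * (G * F)) := by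
            simp only [Matrix.mul_assoc]
        _ = _ := by rw [hEinv, Matrix.mul_one, hWV, Matrix.one_mul]
    have h2 := congrFun (congrFun h1 l) j
    rw [Matrix.diagonal_mul, Matrix.mul_apply] at h2
    rw [← h2]
    simp only [hdiag]
    simp
  obtain ⟨σ, hσ⟩ : ∃ σ : Equiv.Perm (Fin r), ∀ j, (G * F) (σ j) j ≠ 0 := by
    by_contra hcon
    push Not at hcon
    have hdet : (G * F).det ≠ 0 := ((Matrix.isUnit_iff_isUnit_det _).mp hB).ne_zero
    apply hdet
    rw [Matrix.det_apply]
    refine Finset.sum_eq_zero fun σ _ => ?_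
    obtain ⟨j, hj⟩ := hcon σ
    rw [Finset.prod_eq_zero (f := fun i => (G * F) (σ i) i) (Finset.mem_univ j) hj, smul_zero]
  have hscale : ∀ j, ∃ e : ℂ, e ≠ 0 ∧ ∀ i, ξ' j i = e * ξ (σ j) i := by
    intro j
    have hb := hσ j
    have hL : L (σ j) (ρ j) ≠ 0 := by
      intro h0
      apply hξ0 (σ j)
      funext i
      have := key i (σ j) j
      rw [h0, zero_mul] at this
      simpa [hb] using this
    refine ⟨(starRingEnd ℂ) ((G * F) (σ j) j / L (σ j) (ρ j)), ?_, ?_⟩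
    · rw [map_ne_zero]
      exact div_ne_zero hb hL
    · intro i
      apply (starRingEnd ℂ).injective
      rw [hξ', map_mul, Complex.conj_conj]
      have := key i (σ j) j
      field_simp
      linear_combination -this
  choose e he0 he using hscale
  have hlin : ∀ j, linForm (ξ' j) = C (e j) * linForm (ξ (σ j)) := by
    intro j
    unfold linForm
    rw [Finset.mul_sum]
    refine Finset.sum_congr rfl fun i _ => ?_
    rw [he, C_mul, mul_assoc]
  refine ⟨fun j => ω (σ j) / e j ^ d, ?_, ?_⟩
  · simp only
    rw [hT, ← Equiv.sum_comp σ]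
    refine Finset.sum_congr rfl fun j _ => ?_
    rw [hlin, mul_pow, ← mul_assoc, ← C_pow, ← C_mul, div_mul_cancel₀ _ (pow_ne_zero _ (he0 j))]
  · intro ω'' h''
    have hco : ∀ α : Finset.Nat.antidiagonalTuple m d,
        ∑ j, (ω'' j * e j ^ d - ω (σ j)) * ∏ l, ξ (σ j) l ^ (α : Fin m → ℕ) l = 0 := by
      intro α
      have hα := Finset.Nat.mem_antidiagonalTuple.mp α.2
      have h3 := congrArg (coeff (Finsupp.equivFunOnFinite.symm (α : Fin m → ℕ))) (h''.symm.trans hT)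
      rw [← Equiv.sum_comp σ (fun i => C (ω i) * linForm (ξ i) ^ d)] at h3
      simp only [hlin, mul_pow, ← C_pow, coeff_sum, coeff_C_mul,
        aux_coeff_linForm _ d _ hα] at h3
      have hM : (Nat.multinomial (Finsupp.equivFunOnFinite.symm (α : Fin m → ℕ)).support
          (α : Fin m → ℕ) : ℂ) ≠ 0 := by
        exact_mod_cast (Nat.multinomial_pos _ _).ne'
      apply mul_left_cancel₀ hM
      rw [mul_zero, ← sub_eq_zero.mpr h3, ← Finset.sum_sub_distrib, Finset.mul_sum]
      refine Finset.sum_congr rfl fun j _ => ?_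
      ring
    funext i
    have h4 : ∑ α : Finset.Nat.antidiagonalTuple m d, c' (σ i) α *
        ∑ j, (ω'' j * e j ^ d - ω (σ j)) * ∏ l, ξ (σ j) l ^ (α : Fin m → ℕ) l = 0 := by
      simp [hco]
    have h5 : ∑ j, (ω'' j * e j ^ d - ω (σ j)) * (if σ i = σ j then 1 else 0) = 0 := by
      refine Eq.trans ?_ h4
      simp only [Finset.mul_sum]
      rw [Finset.sum_comm]
      refine Finset.sum_congr rfl fun j _ => ?_
      rw [← hc' (σ i) (σ j), Finset.mul_sum]
      refine Finset.sum_congr rfl fun _ _ => ?_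
      ring
    simp only [EmbeddingLike.apply_eq_iff_eq, mul_ite, mul_one, mul_zero, Finset.sum_ite_eq,
      Finset.mem_univ, if_true] at h5
    rw [eq_div_iff (pow_ne_zero _ (he0 i))]
    exact sub_eq_zero.mp h5
end
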